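/- Suppose m = d, B* ∈ ℝ^{d×d} is invertible, and A* ∈ ℝ^{d×d} is entrywise nonnegative, invertible, and is not a scale transformation with respect to any component (for every j there exists j' ≠ j with A*_{j,j'} ≠ 0). Let μ be a probability measure on ℝ^d with full support. Then for every matrix C ∈ ℝ^{d×d} and every continuous function h : ℝ^d → ℝ^d with h(x) ≥ 0 for all x, the (possibly infinite) integral G₂(C,h) = (1/2)∫ ‖h(x) + x − C·y(x)‖² dμ(x) equals 0 if and only if C = (B*)⁻¹ and h(x) = (A*x)⁺ for all x ∈ ℝ^d. -/

import Mathlib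

open MeasureTheory Matrix

/-- Entrywise rectifier (ReLU). -/
def relu {k : ℕ} (v : Fin k → ℝ) : Fin k → ℝ := fun i => max (v i) 0

/-- The ground-truth residual unit. -/
def resUnit {d m : ℕ} (A : Matrix (Fin d) (Fin d) ℝ) (B : Matrix (Fin m) (Fin d) ℝ)
    (x : Fin d → ℝ) : Fin m → ℝ :=
  B.mulVec (relu (A.mulVec x) + x)

lemma relu_continuous {k : ℕ} : Continuous (relu : (Fin k → ℝ) → Fin k → ℝ) := by
  unfold relu
  fun_prop

lemma key_eq_one {d : ℕ} (A M : Matrix (Fin d) (Fin d) ℝ)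
    (hAnn : ∀ i j, 0 ≤ A i j) (hAinv : IsUnit A.det)
    (hAns : ∀ j : Fin d, ∃ j', j' ≠ j ∧ A j j' ≠ 0)
    (H : ∀ x i, x i ≤ M.mulVec (relu (A.mulVec x) + x) i) : M = 1 := by
  obtain ⟨N, hN⟩ : ∃ N, N = (M - 1) * A⁻¹ := ⟨_, rfl⟩
  have hNA : N * A = M - 1 := by
    rw [hN, Matrix.mul_assoc, Matrix.nonsing_inv_mul A hAinv, Matrix.mul_one]
  have hval : ∀ z i, 0 ≤ M.mulVec (relu z) i + N.mulVec z i := by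
    intro z i
    have h1 := H (A⁻¹.mulVec z) i
    rw [Matrix.mulVec_mulVec, Matrix.mul_nonsing_inv A hAinv, Matrix.one_mulVec,
      Matrix.mulVec_add] at h1
    have h2 : N.mulVec z = M.mulVec (A⁻¹.mulVec z) - A⁻¹.mulVec z := by
      rw [hN, ← Matrix.mulVec_mulVec, Matrix.sub_mulVec, Matrix.one_mulVec]
    rw [h2]
    simp only [Pi.add_apply, Pi.sub_apply] at h1 ⊢
    linarith
  have hp : ∀ i k, 0 ≤ M i k + N i k := by
    intro i k
    have h1 := hval (Pi.single k 1) i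
    have h2 : relu (Pi.single k (1:ℝ)) = Pi.single k (1:ℝ) := by
      funext l
      by_cases hl : l = k
      · subst hl; simp [relu]
      · simp [relu, hl]
    rw [h2] at h1
    simpa using h1
  have hn : ∀ i k, N i k ≤ 0 := by
    intro i k
    have h1 := hval (-Pi.single k 1) i
    have h2 : relu (-Pi.single k (1:ℝ)) = 0 := by
      funext l
      by_cases hl : l = k
      · subst hl; simp [relu]
      · simp [relu, hl]
    rw [h2, Matrix.mulVec_neg] at h1
    simpa using h1
  have hs : ∀ i k, (M - 1) i k ≤ 0 := by
    intro i k
    rw [← hNA, Matrix.mul_apply]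
    exact Finset.sum_nonpos fun l _ => mul_nonpos_of_nonpos_of_nonneg (hn i l) (hAnn l k)
  have hM0 : ∀ i k, k ≠ i → M i k = 0 ∧ N i k = 0 := by
    intro i k hk
    have h1 := hs i k
    rw [Matrix.sub_apply, Matrix.one_apply_ne hk.symm] at h1
    have h2 := hp i k
    have h3 := hn i k
    constructor <;> linarith
  have hrow : ∀ i k, (M - 1) i k = N i i * A i k := by
    intro i k
    rw [← hNA, Matrix.mul_apply]
    apply Finset.sum_eq_single i
    · intro l _ hl
      rw [(hM0 i l hl).2, zero_mul]
    · simp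
  have hNii : ∀ i, N i i = 0 := by
    intro i
    obtain ⟨k, hk, hA⟩ := hAns i
    have h1 := hrow i k
    rw [Matrix.sub_apply, Matrix.one_apply_ne hk.symm, (hM0 i k hk).1, sub_zero] at h1
    exact (mul_eq_zero.mp h1.symm).resolve_right hA
  rw [← sub_eq_zero]
  ext i k
  rw [hrow, hNii, zero_mul, Matrix.zero_apply]

theorem stmt0 (d : ℕ) (hd : 1 ≤ d)
    (Astar Bstar : Matrix (Fin d) (Fin d) ℝ)
    (hAnn : ∀ i j, 0 ≤ Astar i j)
    (hAinv : IsUnit Astar.det) (hBinv : IsUnit Bstar.det)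
    (hAns : ∀ j : Fin d, ∃ j', j' ≠ j ∧ Astar j j' ≠ 0)
    (μ : Measure (Fin d → ℝ)) [IsProbabilityMeasure μ]
    (hsupp : ∀ U : Set (Fin d → ℝ), IsOpen U → U.Nonempty → 0 < μ U)
    (C : Matrix (Fin d) (Fin d) ℝ)
    (h : (Fin d → ℝ) → Fin d → ℝ)
    (hcont : Continuous h) (hpos : ∀ x i, 0 ≤ h x i) :
    (∫⁻ x, ENNReal.ofReal
        (2⁻¹ * ∑ i, (h x i + x i - C.mulVec (resUnit Astar Bstar x) i) ^ 2) ∂μ) = 0 ↔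
      C = Bstar⁻¹ ∧ ∀ x, h x = relu (Astar.mulVec x) := by
  have hC : ∀ x, C.mulVec (resUnit Astar Bstar x)
      = (C * Bstar).mulVec (relu (Astar.mulVec x) + x) := by
    intro x
    rw [resUnit, Matrix.mulVec_mulVec]
  simp only [hC]
  constructor
  · intro h0
    have : μ.IsOpenPosMeasure := ⟨fun U hU hne => (hsupp U hU hne).ne'⟩
    have hrc : Continuous fun x : Fin d → ℝ => relu (Astar.mulVec x) :=
      relu_continuous.comp (by fun_prop)
    have hcF : Continuous fun x : Fin d → ℝ => ENNReal.ofReal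
        (2⁻¹ * ∑ i, (h x i + x i - (C * Bstar).mulVec (relu (Astar.mulVec x) + x) i) ^ 2) := by
      apply ENNReal.continuous_ofReal.comp
      have hm : Continuous fun x : Fin d → ℝ =>
          (C * Bstar).mulVec (relu (Astar.mulVec x) + x) :=
        continuous_const.matrix_mulVec (hrc.add continuous_id)
      fun_prop
    rw [lintegral_eq_zero_iff hcF.measurable] at h0
    have h1 := (Continuous.ae_eq_iff_eq μ hcF continuous_zero).mp h0
    have h2 : ∀ x i, h x i + x i = (C * Bstar).mulVec (relu (Astar.mulVec x) + x) i := by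
      intro x i
      have h3 := congrFun h1 x
      simp only [Pi.zero_apply, ENNReal.ofReal_eq_zero] at h3
      have h4 := Finset.single_le_sum (f := fun i => (h x i + x i -
        (C * Bstar).mulVec (relu (Astar.mulVec x) + x) i) ^ 2)
        (fun i _ => sq_nonneg _) (Finset.mem_univ i)
      have h5 : (h x i + x i - (C * Bstar).mulVec (relu (Astar.mulVec x) + x) i) ^ 2 = 0 :=
        le_antisymm (by linarith) (sq_nonneg _)
      exact sub_eq_zero.mp (pow_eq_zero_iff (two_ne_zero) |>.mp h5)
    have hM : C * Bstar = 1 := key_eq_one Astar _ hAnn hAinv hAns (by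
      intro x i
      rw [← h2]
      linarith [hpos x i])
    refine ⟨(Matrix.inv_eq_left_inv hM).symm, fun x => ?_⟩
    funext i
    have h3 := h2 x i
    rw [hM, Matrix.one_mulVec, Pi.add_apply] at h3
    linarith
  · rintro ⟨rfl, hh⟩
    simp [hh, Matrix.nonsing_inv_mul Bstar hBinv]
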